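/- There is a universal constant C > 0 such that for every pure strategy S for G_Rad^{(n)}: ω(S)^{1/2} ≤ C · 𝔼_ε F_V(ε), where F_V(ε) = sup{ ‖ (1/n²) Σ_{i,j=1}^n ε_{ij} ( ⟨i|h ⊗ ⟨j|g ) (V|ij⟩ ⊗ W) ψ ‖ : r' ∈ ℕ; h, g : ℂ^{k̃} → ℂ^n ⊗ ℂ^{r'} of operator norm ≤ 1; W : ℂ^k → ℂ^{k̃} of operator norm ≤ 1; ψ ∈ ℂ^k ⊗ ℂ^k a unit vector }, the norm being the Euclidean norm on ℂ^{r'} ⊗ ℂ^{r'}. Note that F_V(ε) depends only on the first-round map V of the strategy. -/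

import Mathlib

open scoped BigOperators

noncomputable section

abbrev ES (ι : Type) := EuclideanSpace ℂ ι

def sgn (b : Bool) : ℂ := if b then 1 else -1

def sgnR (b : Bool) : ℝ := if b then 1 else -1

/-- Uniform average of a real-valued function over a finite type. -/
def Eavg {α : Type} [Fintype α] (f : α → ℝ) : ℝ := (∑ x, f x) / (Fintype.card α : ℝ)

/-- Uniform average of a vector-valued function over a finite type. -/
def EavgV {α : Type} [Fintype α] {X : Type} [AddCommGroup X] [Module ℂ X] (f : α → X) : X :=
  (Fintype.card α : ℂ)⁻¹ • ∑ x, f x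

/-- The matrix of a continuous linear map between Euclidean spaces. -/
def matOf {ι κ : Type} [Fintype ι] [Fintype κ] [DecidableEq ι] (f : ES ι →L[ℂ] ES κ) :
    Matrix κ ι ℂ := Matrix.toEuclideanLin.symm (f : ES ι →ₗ[ℂ] ES κ)

/-- The continuous linear map between Euclidean spaces given by a matrix. -/
def ofMat {ι κ : Type} [Fintype ι] [Fintype κ] [DecidableEq ι] (M : Matrix κ ι ℂ) :
    ES ι →L[ℂ] ES κ := LinearMap.toContinuousLinearMap (Matrix.toEuclideanLin M)

/-- Tensor product of two (continuous) linear maps between Euclidean spaces, realized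
via the Kronecker product of their matrices. -/
def tensorCLM {ι₁ ι₂ κ₁ κ₂ : Type} [Fintype ι₁] [Fintype ι₂] [Fintype κ₁] [Fintype κ₂]
    [DecidableEq ι₁] [DecidableEq ι₂]
    (f : ES ι₁ →L[ℂ] ES κ₁) (g : ES ι₂ →L[ℂ] ES κ₂) :
    ES (ι₁ × ι₂) →L[ℂ] ES (κ₁ × κ₂) :=
  ofMat (Matrix.kroneckerMap (· * ·) (matOf f) (matOf g))

/-- The isometry `ℂ^k → ℂ^n ⊗ ℂ^n ⊗ ℂ^k`, `x ↦ e_i ⊗ e_j ⊗ x`. -/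
def embedAB {n k : ℕ} (i j : Fin n) : ES (Fin k) →L[ℂ] ES (Fin n × Fin n × Fin k) :=
  ofMat (Matrix.of fun p c => if p.1 = i ∧ p.2.1 = j ∧ p.2.2 = c then 1 else 0)

/-- `V|ij⟩ : ℂ^k → ℂ^{k̃}`, the map `x ↦ V(e_i ⊗ e_j ⊗ x)`. -/
def Vij {n k k' : ℕ} (V : ES (Fin n × Fin n × Fin k) →L[ℂ] ES (Fin k')) (i j : Fin n) :
    ES (Fin k) →L[ℂ] ES (Fin k') := V.comp (embedAB i j)

/-- `e_i^* ⊗ Id : ℂ^n ⊗ ℂ^r → ℂ^r`. -/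
def proj {n r : ℕ} (i : Fin n) : ES (Fin n × Fin r) →L[ℂ] ES (Fin r) :=
  ofMat (Matrix.of fun s p => if p.1 = i ∧ p.2 = s then 1 else 0)

/-- A pure strategy for the game `G_Rad^{(n)}` with dimensions `k, k', r`. -/
structure PureStrategy (n k k' r : ℕ) where
  V : ES (Fin n × Fin n × Fin k) →L[ℂ] ES (Fin k')
  W : ((Fin n × Fin n) → Bool) → ES (Fin k) →L[ℂ] ES (Fin k')
  Vt : ((Fin n × Fin n) → Bool) → ES (Fin k') →L[ℂ] ES (Fin n × Fin r)
  Wt : ((Fin n × Fin n) → Bool) → ES (Fin k') →L[ℂ] ES (Fin n × Fin r)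
  φ : ES (Fin k × Fin k)
  hV : ‖V‖ ≤ 1
  hW : ∀ ε, ‖W ε‖ ≤ 1
  hVt : ∀ ε, ‖Vt ε‖ ≤ 1
  hWt : ∀ ε, ‖Wt ε‖ ≤ 1
  hφ : ‖φ‖ = 1

/-- The value `ω(S)` of a pure strategy in `G_Rad^{(n)}`. -/
def value {n k k' r : ℕ} (S : PureStrategy n k k' r) : ℝ :=
  Eavg fun ε => ‖((n : ℂ) ^ 2)⁻¹ • ∑ ij : Fin n × Fin n, sgn (ε ij) •
    (tensorCLM ((proj ij.1).comp (S.Vt ε)) ((proj ij.2).comp (S.Wt ε)))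
      ((tensorCLM (Vij S.V ij.1 ij.2) (S.W ε)) S.φ)‖ ^ 2

/-- The assignment `Φ^i_S : {−1,1}^{n×n} → B(ℂ^k ⊗ ℂ^{k̃}, ℂ^r ⊗ ℂ^r)`. -/
def PhiI {n k k' r : ℕ} (S : PureStrategy n k k' r) (ε : (Fin n × Fin n) → Bool) :
    ES (Fin k × Fin k') →L[ℂ] ES (Fin r × Fin r) :=
  ((n : ℂ) ^ 2)⁻¹ • ∑ ij : Fin n × Fin n, sgn (ε ij) •
    ((tensorCLM ((proj ij.1).comp (S.Vt ε)) ((proj ij.2).comp (S.Wt ε))).comp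
      (tensorCLM (Vij S.V ij.1 ij.2) (ContinuousLinearMap.id ℂ (ES (Fin k')))))

/-- Flip the `p`-th sign of `ε`. -/
def flipAt {ι : Type} [DecidableEq ι] (ε : ι → Bool) (p : ι) : ι → Bool :=
  Function.update ε p (!(ε p))

/-- The regularity parameter `σ_Φ` of a map on the Boolean hypercube with values in a
normed space; `‖∂_pΦ(ε)‖ = ‖Φ(ε) − Φ(ε̄^p)‖/2`. -/
def sigma {ι : Type} [Fintype ι] [DecidableEq ι] {X : Type} [NormedAddCommGroup X]
    (Φ : (ι → Bool) → X) : ℝ :=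
  Real.log (Fintype.card ι) *
    Eavg fun ε => Real.sqrt (∑ p : ι, (‖Φ ε - Φ (flipAt ε p)‖ / 2) ^ 2)

/-- The type-2 constant with `m` vectors of a normed space. -/
def T2With (m : ℕ) (X : Type) [NormedAddCommGroup X] [NormedSpace ℝ X] : ℝ :=
  sInf {T : ℝ | 0 ≤ T ∧ ∀ x : Fin m → X,
    Real.sqrt (Eavg fun ε : Fin m → Bool => ‖∑ i, sgnR (ε i) • x i‖ ^ 2)
      ≤ T * Real.sqrt (∑ i, ‖x i‖ ^ 2)}

/-- `ĥ : ℂ^n ⊗ ℂ^{k̃} → ℂ^{r'}` determined by `ĥ(e_i ⊗ y) = (e_i^* ⊗ Id)(h y)`. -/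
def hat {n k' r' : ℕ} (h : ES (Fin k') →L[ℂ] ES (Fin n × Fin r')) :
    ES (Fin n × Fin k') →L[ℂ] ES (Fin r') :=
  ofMat (Matrix.of fun s p => matOf h (p.1, s) p.2)

/-- The norm `N` on `(ℂ^n ⊗ ℂ^{k̃}) ⊗ (ℂ^n ⊗ ℂ^{k̃})`. -/
def Nnorm {n k' : ℕ} (t : ES ((Fin n × Fin k') × (Fin n × Fin k'))) : ℝ :=
  sSup {s : ℝ | ∃ (r' : ℕ) (h g : ES (Fin k') →L[ℂ] ES (Fin n × Fin r')),
    ‖h‖ ≤ 1 ∧ ‖g‖ ≤ 1 ∧ s = ‖(tensorCLM (hat h) (hat g)) t‖}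

/-- `v ↦ e_i ⊗ e_j ⊗ v`, reordered into `(ℂ^n ⊗ ℂ^{k̃}) ⊗ (ℂ^n ⊗ ℂ^{k̃})`. -/
def embedPair {n k' : ℕ} (i j : Fin n) :
    ES (Fin k' × Fin k') →L[ℂ] ES ((Fin n × Fin k') × (Fin n × Fin k')) :=
  ofMat (Matrix.of fun p q => if p.1.1 = i ∧ p.2.1 = j ∧ p.1.2 = q.1 ∧ p.2.2 = q.2 then 1 else 0)

/-- The assignment `Φ^{ii}_S : {−1,1}^{n×n} → (ℂ^n ⊗ ℂ^{k̃}) ⊗ (ℂ^n ⊗ ℂ^{k̃})`. -/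
def PhiII {n k k' r : ℕ} (S : PureStrategy n k k' r) (ε : (Fin n × Fin n) → Bool) :
    ES ((Fin n × Fin k') × (Fin n × Fin k')) :=
  ((n : ℂ) ^ 2)⁻¹ • ∑ ij : Fin n × Fin n, sgn (ε ij) •
    embedPair ij.1 ij.2 ((tensorCLM (Vij S.V ij.1 ij.2) (S.W ε)) S.φ)

/-- `F_V(ε)`: the supremum over second-round isometries `h, g` (of any ancilla dimension `r'`),
first-round maps `W` and shared states `ψ`, of the norm of the sum defining the value,
depending only on the first-round map `V`. -/
def FV {n k k' : ℕ} (V : ES (Fin n × Fin n × Fin k) →L[ℂ] ES (Fin k'))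
    (ε : (Fin n × Fin n) → Bool) : ℝ :=
  sSup {s : ℝ | ∃ (r' : ℕ) (h g : ES (Fin k') →L[ℂ] ES (Fin n × Fin r'))
      (W : ES (Fin k) →L[ℂ] ES (Fin k')) (ψ : ES (Fin k × Fin k)),
      ‖h‖ ≤ 1 ∧ ‖g‖ ≤ 1 ∧ ‖W‖ ≤ 1 ∧ ‖ψ‖ = 1 ∧
      s = ‖((n : ℂ) ^ 2)⁻¹ • ∑ ij : Fin n × Fin n, sgn (ε ij) •
        (tensorCLM ((proj ij.1).comp h) ((proj ij.2).comp g))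
          ((tensorCLM (Vij V ij.1 ij.2) W) ψ)‖}

section Kahane

lemma sum_cons {m : ℕ} (F : (Fin (m+1) → Bool) → ℝ) :
    ∑ ε, F ε = ∑ ε : Fin m → Bool, (F (Fin.cons true ε) + F (Fin.cons false ε)) := by
  rw [← (Fin.consEquiv (fun _ : Fin (m+1) => Bool)).sum_comp, Fintype.sum_prod_type,
    Fintype.sum_bool, ← Finset.sum_add_distrib]
  rfl

lemma flip_cons_zero {m : ℕ} (b : Bool) (ε : Fin m → Bool) :
    flipAt (Fin.cons b ε : Fin (m+1) → Bool) 0 = Fin.cons (!b) ε := by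
  simp [flipAt]

lemma flip_cons_succ {m : ℕ} (b : Bool) (ε : Fin m → Bool) (p : Fin m) :
    flipAt (Fin.cons b ε : Fin (m+1) → Bool) p.succ = Fin.cons b (flipAt ε p) := by
  simp [flipAt, Fin.cons_update]

/-- Squared gradient, summed. -/
def grad {ι : Type} [Fintype ι] [DecidableEq ι] (f : (ι → Bool) → ℝ) : ℝ :=
  ∑ ε, ∑ p, (f ε - f (flipAt ε p)) ^ 2

lemma grad_nonneg {ι : Type} [Fintype ι] [DecidableEq ι] (f : (ι → Bool) → ℝ) : 0 ≤ grad f :=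
  Finset.sum_nonneg fun _ _ => Finset.sum_nonneg fun _ _ => sq_nonneg _

def upart {m : ℕ} (f : (Fin (m+1) → Bool) → ℝ) (ε : Fin m → Bool) : ℝ :=
  f (Fin.cons true ε) + f (Fin.cons false ε)

def vpart {m : ℕ} (f : (Fin (m+1) → Bool) → ℝ) (ε : Fin m → Bool) : ℝ :=
  f (Fin.cons true ε) - f (Fin.cons false ε)

lemma sum_split {m : ℕ} (f : (Fin (m+1) → Bool) → ℝ) : ∑ ε, f ε = ∑ ε, upart f ε := sum_cons f

lemma sq_split {m : ℕ} (f : (Fin (m+1) → Bool) → ℝ) :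
    2 * ∑ ε, f ε ^ 2 = ∑ ε, upart f ε ^ 2 + ∑ ε, vpart f ε ^ 2 := by
  rw [sum_cons, Finset.mul_sum, ← Finset.sum_add_distrib]
  refine Finset.sum_congr rfl fun ε _ => ?_
  simp only [upart, vpart]; ring

lemma grad_split {m : ℕ} (f : (Fin (m+1) → Bool) → ℝ) :
    2 * grad f = grad (upart f) + grad (vpart f) + 4 * ∑ ε, vpart f ε ^ 2 := by
  unfold grad
  rw [sum_cons, Finset.mul_sum, Finset.mul_sum, ← Finset.sum_add_distrib, ← Finset.sum_add_distrib]
  refine Finset.sum_congr rfl fun ε _ => ?_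
  simp only [Fin.sum_univ_succ, flip_cons_zero, flip_cons_succ, Bool.not_true, Bool.not_false]
  have : ∑ p, (upart f ε - upart f (flipAt ε p)) ^ 2 + ∑ p, (vpart f ε - vpart f (flipAt ε p)) ^ 2
      = 2 * ∑ p, (f (Fin.cons true ε) - f (Fin.cons true (flipAt ε p))) ^ 2
        + 2 * ∑ p, (f (Fin.cons false ε) - f (Fin.cons false (flipAt ε p))) ^ 2 := by
    rw [Finset.mul_sum, Finset.mul_sum, ← Finset.sum_add_distrib, ← Finset.sum_add_distrib]
    refine Finset.sum_congr rfl fun p _ => ?_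
    simp only [upart, vpart]; ring
  rw [this]; simp only [vpart]; ring

lemma level_split {m : ℕ} (f : (Fin (m+1) → Bool) → ℝ) :
    ∑ p, (∑ ε, sgnR (ε p) * f ε) ^ 2 =
      (∑ ε, vpart f ε) ^ 2 + ∑ p, (∑ ε, sgnR (ε p) * upart f ε) ^ 2 := by
  rw [Fin.sum_univ_succ]
  congr 1
  · rw [sum_cons]; congr 1
    refine Finset.sum_congr rfl fun ε _ => ?_
    simp [sgnR, vpart]; ring
  · refine Finset.sum_congr rfl fun p _ => ?_
    rw [sum_cons]; congr 1
    refine Finset.sum_congr rfl fun ε _ => ?_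
    simp [upart]; ring

lemma poincare (m : ℕ) : ∀ f : (Fin m → Bool) → ℝ,
    4 * ((2:ℝ) ^ m * ∑ ε, f ε ^ 2 - (∑ ε, f ε) ^ 2) ≤ 2 ^ m * grad f := by
  induction m with
  | zero => intro f; simp [grad]
  | succ m ih =>
    intro f
    have h1 := ih (upart f)
    have h3 := sq_split f
    have h4 := grad_split f
    have hN : (0:ℝ) ≤ 2 ^ m := by positivity
    have h5 := mul_nonneg hN (grad_nonneg (vpart f))
    rw [sum_split f, pow_succ]
    have e1 : (2:ℝ)^m * 2 * grad f = 2^m * (2 * grad f) := by ring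
    have e2 : (2:ℝ)^m * 2 * ∑ ε, f ε ^ 2 = 2^m * (2 * ∑ ε, f ε ^ 2) := by ring
    rw [e1, e2, h3, h4]
    linarith

lemma poincare2 (m : ℕ) : ∀ f : (Fin m → Bool) → ℝ,
    8 * ((2:ℝ) ^ m * ∑ ε, f ε ^ 2 - (∑ ε, f ε) ^ 2) ≤
      2 ^ m * grad f + 4 * ∑ p, (∑ ε, sgnR (ε p) * f ε) ^ 2 := by
  induction m with
  | zero => intro f; simp [grad]
  | succ m ih =>
    intro f
    have h1 := ih (upart f)
    have h2 := poincare m (vpart f)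
    have h3 := sq_split f
    have h4 := grad_split f
    rw [level_split f, sum_split f, pow_succ]
    have e1 : (2:ℝ)^m * 2 * grad f = 2^m * (2 * grad f) := by ring
    have e2 : (2:ℝ)^m * 2 * ∑ ε, f ε ^ 2 = 2^m * (2 * ∑ ε, f ε ^ 2) := by ring
    rw [e1, e2, h3, h4]
    linarith

lemma flipAt_invol {ι : Type} [DecidableEq ι] (p : ι) :
    Function.Involutive (fun ε : ι → Bool => flipAt ε p) := by
  intro ε; simp [flipAt]

lemma neg_invol {ι : Type} : Function.Involutive (fun (ε : ι → Bool) (p : ι) => !(ε p)) := by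
  intro ε; simp

lemma kahane_fin (m : ℕ) (f : (Fin m → Bool) → ℝ) (h0 : ∀ ε, 0 ≤ f ε)
    (heven : ∀ ε, f (fun p => !(ε p)) = f ε)
    (hsub : ∀ ε, ((m:ℝ) - 2) * f ε ≤ ∑ p, f (flipAt ε p)) :
    (2:ℝ) ^ m * ∑ ε, f ε ^ 2 ≤ 2 * (∑ ε, f ε) ^ 2 := by
  have hlev : ∀ p : Fin m, ∑ ε, sgnR (ε p) * f ε = 0 := by
    intro p
    let P : Equiv.Perm (Fin m → Bool) := Function.Involutive.toPerm _ neg_invol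
    have := Equiv.sum_comp P (fun ε => sgnR (ε p) * f ε)
    have h2 : ∑ ε : Fin m → Bool, sgnR (P ε p) * f (P ε)
        = - ∑ ε, sgnR (ε p) * f ε := by
      rw [← Finset.sum_neg_distrib]
      refine Finset.sum_congr rfl fun ε _ => ?_
      simp only [P, Function.Involutive.coe_toPerm, heven]
      cases ε p <;> simp [sgnR]
    linarith
  have hp := poincare2 m f
  simp only [hlev] at hp
  have hg : grad f ≤ 4 * ∑ ε, f ε ^ 2 := by
    have hflip : ∀ p : Fin m, ∑ ε, f (flipAt ε p) ^ 2 = ∑ ε, f ε ^ 2 := fun p =>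
      Equiv.sum_comp (flipAt_invol p).toPerm (fun ε => f ε ^ 2)
    have e : grad f = ∑ ε, (m * f ε ^ 2 - 2 * (f ε * ∑ p, f (flipAt ε p)))
        + ∑ p : Fin m, ∑ ε, f (flipAt ε p) ^ 2 := by
      rw [Finset.sum_comm (f := fun (p : Fin m) ε => f (flipAt ε p) ^ 2), ← Finset.sum_add_distrib]
      refine Finset.sum_congr rfl fun ε _ => ?_
      have : (m:ℝ) * f ε ^ 2 = ∑ p : Fin m, f ε ^ 2 := by simp
      rw [this, Finset.mul_sum, Finset.mul_sum, ← Finset.sum_sub_distrib, ← Finset.sum_add_distrib]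
      refine Finset.sum_congr rfl fun p _ => ?_
      ring
    simp only [hflip, Finset.sum_const, Finset.card_univ, Fintype.card_fin, nsmul_eq_mul] at e
    rw [e, Finset.mul_sum, Finset.mul_sum, ← Finset.sum_add_distrib]
    refine Finset.sum_le_sum fun ε _ => ?_
    have := mul_le_mul_of_nonneg_left (hsub ε) (h0 ε)
    nlinarith
  have hN : (0:ℝ) ≤ 2 ^ m := by positivity
  have := mul_le_mul_of_nonneg_left hg hN
  simp at hp
  linarith

lemma kahane {ι : Type} [Fintype ι] [DecidableEq ι] (f : (ι → Bool) → ℝ) (h0 : ∀ ε, 0 ≤ f ε)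
    (heven : ∀ ε, f (fun p => !(ε p)) = f ε)
    (hsub : ∀ ε, ((Fintype.card ι:ℝ) - 2) * f ε ≤ ∑ p, f (flipAt ε p)) :
    Eavg (fun ε => f ε ^ 2) ≤ 2 * (Eavg f) ^ 2 := by
  let e := Fintype.equivFin ι
  let E : (Fin (Fintype.card ι) → Bool) ≃ (ι → Bool) := (Equiv.arrowCongr e.symm (Equiv.refl Bool))
  have hE : ∀ δ i, E δ i = δ (e i) := fun δ i => rfl
  have key := kahane_fin (Fintype.card ι) (fun δ => f (E δ)) (fun _ => h0 _)
    (fun δ => heven (E δ)) (fun δ => by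
      refine (hsub (E δ)).trans (le_of_eq ?_)
      rw [← e.sum_comp]
      refine Finset.sum_congr rfl fun p _ => ?_
      congr 1
      funext i
      simp only [hE, flipAt, Function.update_apply, e.injective.eq_iff])
  rw [E.sum_comp (fun x => f x ^ 2), E.sum_comp f] at key
  unfold Eavg
  have hc : (Fintype.card (ι → Bool) : ℝ) = 2 ^ Fintype.card ι := by simp
  rw [hc]
  have hN : (0:ℝ) < 2 ^ Fintype.card ι := by positivity
  rw [div_pow, ← mul_div_assoc, div_le_div_iff₀ hN (by positivity)]
  nlinarith [mul_le_mul_of_nonneg_left key hN.le]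

end Kahane

section Bounds

lemma ofMat_apply {ι κ : Type} [Fintype ι] [Fintype κ] [DecidableEq ι] (M : Matrix κ ι ℂ)
    (x : ES ι) (c : κ) : ofMat M x c = ∑ i, M c i * x i := by
  simp [ofMat, Matrix.toEuclideanLin, Matrix.mulVec, dotProduct]

lemma matOf_apply {ι κ : Type} [Fintype ι] [Fintype κ] [DecidableEq ι]
    (f : ES ι →L[ℂ] ES κ) (x : ES ι) (c : κ) : f x c = ∑ i, matOf f c i * x i := by
  rw [← ofMat_apply]
  simp [ofMat, matOf]

lemma tensor_norm_le {ι₁ ι₂ κ₁ κ₂ : Type} [Fintype ι₁] [Fintype ι₂] [Fintype κ₁] [Fintype κ₂]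
    [DecidableEq ι₁] [DecidableEq ι₂]
    (f : ES ι₁ →L[ℂ] ES κ₁) (g : ES ι₂ →L[ℂ] ES κ₂) (x : ES (ι₁ × ι₂)) :
    ‖tensorCLM f g x‖ ≤ ‖f‖ * ‖g‖ * ‖x‖ := by
  -- first apply `g` in the second slot
  let y : ι₁ → ES κ₂ := fun i => g (WithLp.toLp 2 fun b => x (i, b))
  let z : κ₂ → ES κ₁ := fun d => f (WithLp.toLp 2 fun i => y i d)
  have hz : ∀ c d, tensorCLM f g x (c, d) = z d c := by
    intro c d
    simp only [tensorCLM, ofMat_apply, z, y]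
    rw [matOf_apply f]
    simp only [matOf_apply g, Fintype.sum_prod_type, Matrix.kroneckerMap_apply, Finset.mul_sum]
    simp only [mul_assoc]
  have h1 : ∀ d, ‖z d‖ ^ 2 ≤ ‖f‖ ^ 2 * ∑ i, ‖y i d‖ ^ 2 := by
    intro d
    have := f.le_opNorm (WithLp.toLp 2 fun i => y i d)
    have h := pow_le_pow_left₀ (norm_nonneg _) this 2
    rw [mul_pow, EuclideanSpace.norm_sq_eq (WithLp.toLp 2 fun i => y i d)] at h
    exact h
  have h2 : ∀ i, ‖y i‖ ^ 2 ≤ ‖g‖ ^ 2 * ∑ b, ‖x (i, b)‖ ^ 2 := by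
    intro i
    have := g.le_opNorm (WithLp.toLp 2 fun b => x (i, b))
    have h := pow_le_pow_left₀ (norm_nonneg _) this 2
    rw [mul_pow, EuclideanSpace.norm_sq_eq (WithLp.toLp 2 fun b => x (i, b))] at h
    exact h
  have h3 : ‖tensorCLM f g x‖ ^ 2 ≤ (‖f‖ * ‖g‖ * ‖x‖) ^ 2 := by
    calc ‖tensorCLM f g x‖ ^ 2 = ∑ d, ‖z d‖ ^ 2 := by
          rw [EuclideanSpace.norm_sq_eq, Fintype.sum_prod_type, Finset.sum_comm]
          refine Finset.sum_congr rfl fun d _ => ?_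
          rw [EuclideanSpace.norm_sq_eq]
          simp only [hz]
      _ ≤ ∑ d, ‖f‖ ^ 2 * ∑ i, ‖y i d‖ ^ 2 := Finset.sum_le_sum fun d _ => h1 d
      _ = ‖f‖ ^ 2 * ∑ i, ‖y i‖ ^ 2 := by
          rw [← Finset.mul_sum, Finset.sum_comm]
          simp only [EuclideanSpace.norm_sq_eq]
      _ ≤ ‖f‖ ^ 2 * ∑ i, ‖g‖ ^ 2 * ∑ b, ‖x (i, b)‖ ^ 2 := by
          gcongr with i
          exact h2 i
      _ = (‖f‖ * ‖g‖ * ‖x‖) ^ 2 := by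
          rw [← Finset.mul_sum, mul_pow, mul_pow, EuclideanSpace.norm_sq_eq x,
            Fintype.sum_prod_type]
          ring
  exact (sq_le_sq₀ (norm_nonneg _) (by positivity)).1 h3

lemma proj_apply {n r : ℕ} (i : Fin n) (x : ES (Fin n × Fin r)) (s : Fin r) :
    proj i x s = x (i, s) := by
  simp only [proj, ofMat_apply, Matrix.of_apply]
  rw [Finset.sum_eq_single (i, s)]
  · simp
  · rintro ⟨a, b⟩ _ hne
    rw [if_neg, zero_mul]
    rintro ⟨h1, h2⟩
    exact hne (by simp_all)
  · simp

lemma proj_norm {n r : ℕ} (i : Fin n) : ‖(proj i : ES (Fin n × Fin r) →L[ℂ] ES (Fin r))‖ ≤ 1 := by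
  refine ContinuousLinearMap.opNorm_le_bound _ zero_le_one fun x => ?_
  rw [one_mul]
  refine (sq_le_sq₀ (norm_nonneg _) (norm_nonneg _)).1 ?_
  rw [EuclideanSpace.norm_sq_eq, EuclideanSpace.norm_sq_eq, Fintype.sum_prod_type]
  simp only [proj_apply]
  exact Finset.single_le_sum (f := fun a => ∑ s, ‖x (a, s)‖ ^ 2)
    (fun a _ => Finset.sum_nonneg fun _ _ => sq_nonneg _) (Finset.mem_univ i)

lemma sgn_norm (b : Bool) : ‖sgn b‖ = 1 := by cases b <;> simp [sgn]

end Bounds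

section FVfacts

variable {n k k' : ℕ} (V : ES (Fin n × Fin n × Fin k) →L[ℂ] ES (Fin k'))

/-- The vector whose norm appears in `FV`. -/
def vec {r' : ℕ} (h g : ES (Fin k') →L[ℂ] ES (Fin n × Fin r'))
    (W : ES (Fin k) →L[ℂ] ES (Fin k')) (ψ : ES (Fin k × Fin k)) (ε : (Fin n × Fin n) → Bool) :
    ES (Fin r' × Fin r') :=
  ((n : ℂ) ^ 2)⁻¹ • ∑ ij : Fin n × Fin n, sgn (ε ij) •
        (tensorCLM ((proj ij.1).comp h) ((proj ij.2).comp g))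
          ((tensorCLM (Vij V ij.1 ij.2) W) ψ)

lemma comp_le {r' : ℕ} (h : ES (Fin k') →L[ℂ] ES (Fin n × Fin r')) (hh : ‖h‖ ≤ 1) (i : Fin n) :
    ‖(proj i).comp h‖ ≤ 1 :=
  (ContinuousLinearMap.opNorm_comp_le _ _).trans
    (mul_le_one₀ (proj_norm i) (norm_nonneg _) hh)

lemma vec_bound {r' : ℕ} (h g : ES (Fin k') →L[ℂ] ES (Fin n × Fin r'))
    (W : ES (Fin k) →L[ℂ] ES (Fin k')) (ψ : ES (Fin k × Fin k)) (ε : (Fin n × Fin n) → Bool)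
    (hh : ‖h‖ ≤ 1) (hg : ‖g‖ ≤ 1) (hW : ‖W‖ ≤ 1) (hψ : ‖ψ‖ = 1) :
    ‖vec V h g W ψ ε‖ ≤ ‖((n : ℂ) ^ 2)⁻¹‖ * ∑ ij : Fin n × Fin n, ‖Vij V ij.1 ij.2‖ := by
  unfold vec
  rw [norm_smul]
  refine mul_le_mul_of_nonneg_left ?_ (norm_nonneg _)
  refine (norm_sum_le _ _).trans (Finset.sum_le_sum fun ij _ => ?_)
  rw [norm_smul, sgn_norm, one_mul]
  refine (tensor_norm_le _ _ _).trans ?_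
  have h1 : ‖(proj ij.1).comp h‖ * ‖(proj ij.2).comp g‖ ≤ 1 :=
    mul_le_one₀ (comp_le h hh _) (norm_nonneg _) (comp_le g hg _)
  have h2 := tensor_norm_le (Vij V ij.1 ij.2) W ψ
  rw [hψ, mul_one] at h2
  calc _ ≤ 1 * ‖tensorCLM (Vij V ij.1 ij.2) W ψ‖ := by gcongr
    _ ≤ ‖Vij V ij.1 ij.2‖ * ‖W‖ := by rw [one_mul]; exact h2
    _ ≤ ‖Vij V ij.1 ij.2‖ := mul_le_of_le_one_right (norm_nonneg _) hW

lemma le_FV {r' : ℕ} (h g : ES (Fin k') →L[ℂ] ES (Fin n × Fin r'))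
    (W : ES (Fin k) →L[ℂ] ES (Fin k')) (ψ : ES (Fin k × Fin k)) (ε : (Fin n × Fin n) → Bool)
    (hh : ‖h‖ ≤ 1) (hg : ‖g‖ ≤ 1) (hW : ‖W‖ ≤ 1) (hψ : ‖ψ‖ = 1) :
    ‖vec V h g W ψ ε‖ ≤ FV V ε := by
  refine le_csSup ⟨‖((n : ℂ) ^ 2)⁻¹‖ * ∑ ij : Fin n × Fin n, ‖Vij V ij.1 ij.2‖, ?_⟩
    ⟨r', h, g, W, ψ, hh, hg, hW, hψ, rfl⟩
  rintro s ⟨r', h, g, W, ψ, hh, hg, hW, hψ, rfl⟩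
  exact vec_bound V h g W ψ ε hh hg hW hψ

lemma FV_nonneg (ε : (Fin n × Fin n) → Bool) : 0 ≤ FV V ε := by
  refine Real.sSup_nonneg ?_
  rintro s ⟨r', h, g, W, ψ, hh, hg, hW, hψ, rfl⟩
  exact norm_nonneg _

lemma vec_neg {r' : ℕ} (h g : ES (Fin k') →L[ℂ] ES (Fin n × Fin r'))
    (W : ES (Fin k) →L[ℂ] ES (Fin k')) (ψ : ES (Fin k × Fin k)) (ε : (Fin n × Fin n) → Bool) :
    vec V h g W ψ (fun p => !(ε p)) = - vec V h g W ψ ε := by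
  unfold vec
  rw [← smul_neg, ← Finset.sum_neg_distrib]
  congr 1
  refine Finset.sum_congr rfl fun ij _ => ?_
  rw [← neg_smul]
  congr 1
  cases hb : ε ij <;> simp [sgn, hb]

lemma FV_even (ε : (Fin n × Fin n) → Bool) : FV V (fun p => !(ε p)) = FV V ε := by
  have key : ∀ (r' : ℕ) (h g : ES (Fin k') →L[ℂ] ES (Fin n × Fin r'))
    (W : ES (Fin k) →L[ℂ] ES (Fin k')) (ψ : ES (Fin k × Fin k)),
    ‖vec V h g W ψ (fun p => !(ε p))‖ = ‖vec V h g W ψ ε‖ := by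
    intros; rw [vec_neg, norm_neg]
  unfold vec at key
  unfold FV
  simp only [key]

lemma vec_flip {r' : ℕ} (h g : ES (Fin k') →L[ℂ] ES (Fin n × Fin r'))
    (W : ES (Fin k) →L[ℂ] ES (Fin k')) (ψ : ES (Fin k × Fin k)) (ε : (Fin n × Fin n) → Bool) :
    ∑ p, vec V h g W ψ (flipAt ε p) =
      ((Fintype.card (Fin n × Fin n) : ℂ) - 2) • vec V h g W ψ ε := by
  unfold vec
  rw [← Finset.smul_sum, smul_comm, Finset.sum_comm]
  congr 1
  rw [Finset.smul_sum]
  refine Finset.sum_congr rfl fun ij _ => ?_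
  rw [← Finset.sum_smul, smul_smul]
  congr 1
  have : ∀ p, sgn (flipAt ε p ij) = sgn (ε ij) - if ij = p then 2 * sgn (ε ij) else 0 := by
    intro p
    by_cases hp : ij = p
    · subst hp
      cases hb : ε ij <;> simp [flipAt, hb, sgn] <;> norm_num
    · simp [flipAt, hp]
  simp only [this, Finset.sum_sub_distrib, Finset.sum_ite_eq, Finset.mem_univ, if_true,
    Finset.sum_const, Finset.card_univ, nsmul_eq_mul]
  ring

end FVfacts

/-- there is a universal constant `C > 0` such that for every pure strategy
`S` for `G_Rad^{(n)}`: `ω(S)^{1/2} ≤ C · 𝔼_ε F_V(ε)`. -/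
theorem statement7 :
    ∃ C : ℝ, 0 < C ∧
      ∀ (n k k' r : ℕ), 2 ≤ n → 1 ≤ k → 1 ≤ k' → 1 ≤ r →
        ∀ S : PureStrategy n k k' r,
          Real.sqrt (value S) ≤ C * Eavg (FV S.V) := by
  refine ⟨Real.sqrt 2, by positivity, ?_⟩
  intro n k k' r hn _ _ _ S
  have hm : (2:ℝ) ≤ (Fintype.card (Fin n × Fin n) : ℝ) := by
    have : 2 ≤ Fintype.card (Fin n × Fin n) := by
      simp only [Fintype.card_prod, Fintype.card_fin]; nlinarith
    exact_mod_cast this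
  have hsub : ∀ ε, ((Fintype.card (Fin n × Fin n) : ℝ) - 2) * FV S.V ε
      ≤ ∑ p, FV S.V (flipAt ε p) := by
    intro ε
    rcases hm.eq_or_lt with h2 | h2
    · rw [← h2, sub_self, zero_mul]
      exact Finset.sum_nonneg fun p _ => FV_nonneg _ _
    have hpos : 0 < (Fintype.card (Fin n × Fin n) : ℝ) - 2 := by linarith
    rw [← le_div_iff₀' hpos]
    refine csSup_le ⟨_, r, S.Vt ε, S.Wt ε, S.W ε, S.φ, S.hVt ε, S.hWt ε, S.hW ε, S.hφ, rfl⟩ ?_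
    rintro s ⟨r', h, g, W, ψ, hh, hg, hW, hψ, rfl⟩
    rw [le_div_iff₀' hpos]
    change _ * ‖vec S.V h g W ψ ε‖ ≤ _
    have e := congrArg norm (vec_flip S.V h g W ψ ε)
    have ec : ((Fintype.card (Fin n × Fin n) : ℂ) - 2)
        = (((Fintype.card (Fin n × Fin n) : ℝ) - 2 : ℝ) : ℂ) := by push_cast; rfl
    rw [norm_smul, ec, Complex.norm_real, Real.norm_of_nonneg hpos.le] at e
    rw [← e]
    exact (norm_sum_le _ _).trans
      (Finset.sum_le_sum fun p _ => le_FV S.V h g W ψ _ hh hg hW hψ)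
  have hk := kahane (FV S.V) (FV_nonneg S.V) (FV_even S.V) hsub
  have hv : value S ≤ Eavg (fun ε => FV S.V ε ^ 2) := by
    unfold value Eavg
    refine div_le_div_of_nonneg_right (Finset.sum_le_sum fun ε _ => ?_) (Nat.cast_nonneg _)
    exact pow_le_pow_left₀ (norm_nonneg _)
      (le_FV S.V (S.Vt ε) (S.Wt ε) (S.W ε) S.φ ε (S.hVt ε) (S.hWt ε) (S.hW ε) S.hφ) 2
  have hE : 0 ≤ Eavg (FV S.V) :=
    div_nonneg (Finset.sum_nonneg fun ε _ => FV_nonneg _ _) (Nat.cast_nonneg _)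
  calc Real.sqrt (value S) ≤ Real.sqrt (2 * Eavg (FV S.V) ^ 2) := Real.sqrt_le_sqrt (hv.trans hk)
    _ = Real.sqrt 2 * Eavg (FV S.V) := by
      rw [Real.sqrt_mul (by norm_num), Real.sqrt_sq hE]

end
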